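/- arXiv:1501.06075 — 3 statements merged into one kernel-verified Lean document; each statement's English description precedes it below -/
import Mathlib

section
/- The sets S and T are equal: a positive integer n is divisible by no prime q with H(q) = 0 if and only if n ∈ T. -/
/-- The orbit of `n` under `f` reaches `0`. -/
def ReachesZero (f : ℕ → ℕ) (n : ℕ) : Prop := ∃ k, f^[k] n = 0

section ReachesZero

variable {f : ℕ → ℕ}

lemma reachesZero_of_eq_zero {n : ℕ} (h : f n = 0) : ReachesZero f n := ⟨1, h⟩

lemma not_reachesZero_one (hf1 : f 1 = 1) : ¬ReachesZero f 1 := by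
  rintro ⟨k, hk⟩
  rw [Function.iterate_fixed hf1] at hk
  exact one_ne_zero hk

lemma reachesZero_apply_iff (hf0 : f 0 = 0) (n : ℕ) :
    ReachesZero f (f n) ↔ ReachesZero f n := by
  constructor
  · rintro ⟨k, hk⟩
    exact ⟨k + 1, hk⟩
  · rintro ⟨k, hk⟩
    refine ⟨k, ?_⟩
    rw [← Function.iterate_succ_apply, Function.iterate_succ_apply', hk, hf0]

lemma iterate_eq_zero_of_reachesZero (hf0 : f 0 = 0) (hf1 : f 1 = 1)
    (hlt : ∀ n, 1 < n → f n < n) {n m : ℕ} (h : ReachesZero f n) (hnm : n ≤ m) :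
    f^[m] n = 0 := by
  induction m generalizing n with
  | zero => simpa using hnm
  | succ m ih =>
    rw [Function.iterate_succ_apply]
    refine ih ((reachesZero_apply_iff hf0 n).2 h) ?_
    rcases Nat.lt_trichotomy n 1 with h1 | rfl | h1
    · obtain rfl : n = 0 := by omega
      simp [hf0]
    · exact absurd h (not_reachesZero_one hf1)
    · have := hlt n h1
      omega

end ReachesZero

section Multiplicative

variable {f : ℕ → ℕ}

lemma apply_lt_of_coprime_mul
    (hmul : ∀ m n : ℕ, Nat.Coprime m n → f (m * n) = f m * f n)
    (hI : ∀ p α : ℕ, p.Prime → 1 ≤ α → f (p ^ α) < p ^ α) {n : ℕ} (hn : 1 < n) :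
    f n < n := by
  induction n using Nat.recOnPosPrimePosCoprime with
  | prime_pow p a hp ha => exact hI p a hp ha
  | zero => omega
  | one => omega
  | coprime a b ha hb hab iha ihb =>
    rw [hmul a b hab]
    exact Nat.mul_lt_mul'' (iha ha) (ihb hb)

lemma exists_prime_pow_of_prime_dvd_apply (hf1 : f 1 = 1)
    (hmul : ∀ m n : ℕ, Nat.Coprime m n → f (m * n) = f m * f n)
    {n q : ℕ} (hn : 0 < n) (hq : q.Prime) (hqn : q ∣ f n) :
    ∃ p α : ℕ, p.Prime ∧ p ∣ n ∧ 1 ≤ α ∧ q ∣ f (p ^ α) := by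
  induction n using Nat.recOnPosPrimePosCoprime with
  | prime_pow p a hp ha => exact ⟨p, a, hp, dvd_pow_self p ha.ne', ha, hqn⟩
  | zero => omega
  | one =>
    rw [hf1] at hqn
    exact absurd hqn hq.not_dvd_one
  | coprime a b ha hb hab iha ihb =>
    rw [hmul a b hab, hq.dvd_mul] at hqn
    rcases hqn with h | h
    · obtain ⟨p, α, hp, hpn, h⟩ := iha (by omega) h
      exact ⟨p, α, hp, hpn.mul_right b, h⟩
    · obtain ⟨p, α, hp, hpn, h⟩ := ihb (by omega) h
      exact ⟨p, α, hp, hpn.mul_left a, h⟩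

lemma exists_prime_apply_eq_zero (hf1 : f 1 = 1)
    (hmul : ∀ m n : ℕ, Nat.Coprime m n → f (m * n) = f m * f n)
    (hIII : ∀ p α q : ℕ, p.Prime → 1 ≤ α → q.Prime → q ∣ f (p ^ α) → q ∣ p * f p)
    {n : ℕ} (hn : 0 < n) (hfn : f n = 0) : ∃ p : ℕ, p.Prime ∧ p ∣ n ∧ f p = 0 := by
  induction n using Nat.recOnPosPrimePosCoprime with
  | prime_pow p a hp ha =>
    refine ⟨p, hp, dvd_pow_self p ha.ne', ?_⟩
    by_contra h
    obtain ⟨q, hlt, hq⟩ := Nat.exists_infinite_primes (p * f p + 1)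
    have hdvd := hIII p a q hp ha hq (hfn ▸ dvd_zero q)
    have := Nat.le_of_dvd (Nat.mul_pos hp.pos (Nat.pos_of_ne_zero h)) hdvd
    omega
  | zero => omega
  | one => omega
  | coprime a b ha hb hab iha ihb =>
    rw [hmul a b hab, mul_eq_zero] at hfn
    rcases hfn with h | h
    · obtain ⟨p, hp, hpn, h⟩ := iha (by omega) h
      exact ⟨p, hp, hpn.mul_right b, h⟩
    · obtain ⟨p, hp, hpn, h⟩ := ihb (by omega) h
      exact ⟨p, hp, hpn.mul_left a, h⟩

lemma apply_prime_dvd_apply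
    (hmul : ∀ m n : ℕ, Nat.Coprime m n → f (m * n) = f m * f n)
    (hII : ∀ p α : ℕ, p.Prime → 1 ≤ α → f p ∣ f (p ^ α))
    {n p : ℕ} (hn : 0 < n) (hp : p.Prime) (hpn : p ∣ n) : f p ∣ f n := by
  obtain ⟨a, m, hm, rfl⟩ := Nat.exists_eq_pow_mul_and_not_dvd hn.ne' p hp.ne_one
  have ha : 1 ≤ a := by
    by_contra h
    obtain rfl : a = 0 := by omega
    simp [hm] at hpn
  rw [hmul _ _ (((Nat.Prime.coprime_iff_not_dvd hp).2 hm).pow_left a)]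
  exact (hII p a hp ha).mul_right _

lemma reachesZero_iff_exists_prime (hf0 : f 0 = 0) (hf1 : f 1 = 1)
    (hmul : ∀ m n : ℕ, Nat.Coprime m n → f (m * n) = f m * f n)
    (hI : ∀ p α : ℕ, p.Prime → 1 ≤ α → f (p ^ α) < p ^ α)
    (hII : ∀ p α : ℕ, p.Prime → 1 ≤ α → f p ∣ f (p ^ α))
    (hIII : ∀ p α q : ℕ, p.Prime → 1 ≤ α → q.Prime → q ∣ f (p ^ α) → q ∣ p * f p)
    {n : ℕ} (hn : 0 < n) :
    ReachesZero f n ↔ ∃ p : ℕ, p.Prime ∧ p ∣ n ∧ ReachesZero f p := by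
  induction n using Nat.strong_induction_on with
  | _ n ih =>
  obtain rfl | hn1 : n = 1 ∨ 1 < n := by omega
  · refine iff_of_false (not_reachesZero_one hf1) ?_
    rintro ⟨p, hp, hp1, -⟩
    exact hp.not_dvd_one hp1
  have hlt := apply_lt_of_coprime_mul hmul hI hn1
  have prime_lt {p : ℕ} (hp : p.Prime) (hpn : p ∣ n) : f p < n :=
    (apply_lt_of_coprime_mul hmul hI hp.one_lt).trans_le (Nat.le_of_dvd hn hpn)
  constructor
  · intro h
    rcases Nat.eq_zero_or_pos (f n) with h0 | hpos
    · obtain ⟨p, hp, hpn, h⟩ := exists_prime_apply_eq_zero hf1 hmul hIII hn h0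
      exact ⟨p, hp, hpn, reachesZero_of_eq_zero h⟩
    obtain ⟨q, hq, hqn, hqz⟩ := (ih _ hlt hpos).1 ((reachesZero_apply_iff hf0 n).2 h)
    obtain ⟨p, α, hp, hpn, hα, hqp⟩ := exists_prime_pow_of_prime_dvd_apply hf1 hmul hn hq hqn
    refine ⟨p, hp, hpn, ?_⟩
    rcases hq.dvd_mul.1 (hIII p α q hp hα hq hqp) with h | h
    · exact (Nat.prime_dvd_prime_iff_eq hq hp).1 h ▸ hqz
    · rcases Nat.eq_zero_or_pos (f p) with hp0 | hp0
      · exact reachesZero_of_eq_zero hp0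
      · exact (reachesZero_apply_iff hf0 p).1 ((ih _ (prime_lt hp hpn) hp0).2 ⟨q, hq, h, hqz⟩)
  · rintro ⟨p, hp, hpn, hpz⟩
    rcases Nat.eq_zero_or_pos (f n) with h0 | hpos
    · exact reachesZero_of_eq_zero h0
    have hdvd := apply_prime_dvd_apply hmul hII hn hp hpn
    obtain ⟨q, hq, hqp, hqz⟩ := (ih _ (prime_lt hp hpn) (Nat.pos_of_dvd_of_pos hdvd hpos)).1
      ((reachesZero_apply_iff hf0 p).2 hpz)
    exact (reachesZero_apply_iff hf0 n).1 ((ih _ hlt hpos).2 ⟨q, hq, hqp.trans hdvd, hqz⟩)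

end Multiplicative

lemma mem_iff_forall_prime_dvd_mem {T : Set ℕ} (hT1 : 1 ∈ T)
    (hTcomp : ∀ x : ℕ, 1 < x → ¬x.Prime →
      (x ∈ T ↔ ∃ a b : ℕ, a ∈ T ∧ b ∈ T ∧ 1 < a ∧ 1 < b ∧ a * b = x))
    {n : ℕ} (hn : 0 < n) : n ∈ T ↔ ∀ p : ℕ, p.Prime → p ∣ n → p ∈ T := by
  induction n using Nat.strong_induction_on with
  | _ n ih =>
  obtain rfl | hn1 : n = 1 ∨ 1 < n := by omega
  · exact iff_of_true hT1 fun p hp hp1 => absurd hp1 hp.not_dvd_one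
  by_cases hprime : n.Prime
  · refine ⟨fun h p hp hpn => ?_, fun h => h n hprime dvd_rfl⟩
    rwa [(Nat.prime_dvd_prime_iff_eq hp hprime).1 hpn]
  rw [hTcomp n hn1 hprime]
  constructor
  · rintro ⟨a, b, ha, hb, ha1, hb1, rfl⟩ p hp hpn
    rcases hp.dvd_mul.1 hpn with h | h
    · exact (ih a (by nlinarith) (by omega)).1 ha p hp h
    · exact (ih b (by nlinarith) (by omega)).1 hb p hp h
  · intro h
    obtain ⟨a, b, ha, hb, rfl⟩ := (Nat.not_prime_iff_exists_mul_eq hn1).1 hprime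
    have ha1 : 1 < a := by nlinarith
    have hb1 : 1 < b := by nlinarith
    exact ⟨a, b, (ih a ha (by omega)).2 fun p hp hpa => h p hp (hpa.mul_right b),
      (ih b hb (by omega)).2 fun p hp hpb => h p hp (hpb.mul_left a), ha1, hb1, rfl⟩

theorem stmt3 (f : ℕ → ℕ) (hf0 : f 0 = 0) (hf1 : f 1 = 1)
    (hmul : ∀ m n : ℕ, Nat.Coprime m n → f (m * n) = f m * f n)
    (hI : ∀ p α : ℕ, p.Prime → 1 ≤ α → f (p ^ α) < p ^ α)
    (hII : ∀ p α : ℕ, p.Prime → 1 ≤ α → f p ∣ f (p ^ α))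
    (hIII : ∀ p α q : ℕ, p.Prime → 1 ≤ α → q.Prime → q ∣ f (p ^ α) → q ∣ p * f p)
    (T : Set ℕ) (hTpos : ∀ n ∈ T, 0 < n) (hT1 : (1 : ℕ) ∈ T)
    (hTprime : ∀ p : ℕ, p.Prime → (p ∈ T ↔ f p ∈ T))
    (hTcomp : ∀ x : ℕ, 1 < x → ¬x.Prime →
      (x ∈ T ↔ ∃ a b : ℕ, a ∈ T ∧ b ∈ T ∧ 1 < a ∧ 1 < b ∧ a * b = x)) :
    ∀ n : ℕ, 0 < n → ((∀ q : ℕ, q.Prime → f^[q] q = 0 → ¬q ∣ n) ↔ n ∈ T) := by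
  have hreach (n : ℕ) (hn : 0 < n) :=
    reachesZero_iff_exists_prime hf0 hf1 hmul hI hII hIII hn
  have hmem (n : ℕ) (hn : 0 < n) := mem_iff_forall_prime_dvd_mem hT1 hTcomp hn
  have hlt (n : ℕ) (hn : 1 < n) : f n < n := apply_lt_of_coprime_mul hmul hI hn
  have hprime (p : ℕ) (hp : p.Prime) : p ∈ T ↔ ¬ReachesZero f p := by
    induction p using Nat.strong_induction_on with
    | _ p ih =>
    rw [hTprime p hp]
    rcases Nat.eq_zero_or_pos (f p) with h0 | hpos
    · refine iff_of_false (fun h => (hTpos _ h).ne' h0) fun h => h (reachesZero_of_eq_zero h0)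
    rw [← reachesZero_apply_iff hf0 p, hmem _ hpos, hreach _ hpos]
    push Not
    refine forall₃_congr fun q hq hqp => ih q ?_ hq
    exact (Nat.le_of_dvd hpos hqp).trans_lt (hlt p hp.one_lt)
  intro n hn
  rw [hmem n hn]
  refine forall₂_congr fun q hq => ?_
  have hH : f^[q] q = 0 ↔ ReachesZero f q :=
    ⟨fun h => ⟨q, h⟩, fun h => iterate_eq_zero_of_reachesZero hf0 hf1 hlt h le_rfl⟩
  rw [hprime q hq, hH, imp_not_comm]
end

section
/- For every positive integer k, H(k) = 1 if and only if k ∈ S; equivalently, H(k) = 1 if and only if no prime q with H(q) = 0 divides k. -/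
/-- A multiplicative function lying below the identity at prime powers lies below it on `n > 1`. -/
lemma multiplicative_lt_self {f : ℕ → ℕ}
    (hmul : ∀ m n : ℕ, Nat.Coprime m n → f (m * n) = f m * f n)
    (hlt : ∀ p α : ℕ, p.Prime → 1 ≤ α → f (p ^ α) < p ^ α) (n : ℕ) :
    1 < n → f n < n := by
  induction n using Nat.recOnPosPrimePosCoprime with
  | zero => omega
  | one => omega
  | prime_pow p n hp hn => exact fun _ => hlt p n hp hn
  | coprime a b ha hb hab iha ihb =>
    intro _
    rw [hmul a b hab]
    exact Nat.mul_lt_mul'' (iha ha) (ihb hb)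

lemma exists_prime_dvd_mul_of_dvd_multiplicative {f : ℕ → ℕ} (hf1 : f 1 = 1)
    (hmul : ∀ m n : ℕ, Nat.Coprime m n → f (m * n) = f m * f n)
    (hsupp : ∀ p α q : ℕ, p.Prime → 1 ≤ α → q.Prime → q ∣ f (p ^ α) → q ∣ p * f p)
    {q : ℕ} (hq : q.Prime) (n : ℕ) :
    0 < n → q ∣ f n → ∃ p, p.Prime ∧ p ∣ n ∧ q ∣ p * f p := by
  induction n using Nat.recOnPosPrimePosCoprime with
  | zero => omega
  | one =>
    intro _ h
    rw [hf1] at h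
    exact absurd h hq.not_dvd_one
  | prime_pow p n hp hn =>
    exact fun _ h => ⟨p, hp, dvd_pow_self p hn.ne', hsupp p n q hp hn hq h⟩
  | coprime a b ha hb hab iha ihb =>
    intro _ h
    rw [hmul a b hab] at h
    rcases hq.dvd_mul.1 h with h | h
    · obtain ⟨p, hp, hpa, hqp⟩ := iha (by omega) h
      exact ⟨p, hp, hpa.mul_right b, hqp⟩
    · obtain ⟨p, hp, hpb, hqp⟩ := ihb (by omega) h
      exact ⟨p, hp, hpb.mul_left a, hqp⟩

lemma multiplicative_prime_dvd {f : ℕ → ℕ}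
    (hmul : ∀ m n : ℕ, Nat.Coprime m n → f (m * n) = f m * f n)
    (hdvd : ∀ p α : ℕ, p.Prime → 1 ≤ α → f p ∣ f (p ^ α))
    {q n : ℕ} (hq : q.Prime) (hn : 0 < n) (hqn : q ∣ n) : f q ∣ f n := by
  obtain ⟨a, m, hm, rfl⟩ := Nat.exists_eq_pow_mul_and_not_dvd hn.ne' q hq.ne_one
  have ha : 1 ≤ a := by
    rcases Nat.eq_zero_or_pos a with rfl | ha
    · simp [hm] at hqn
    · exact ha
  rw [hmul _ _ (((hq.coprime_iff_not_dvd).2 hm).pow_left a)]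
  exact (hdvd q a hq ha).mul_right _

lemma multiplicative_pos {f : ℕ → ℕ} (hf1 : f 1 = 1)
    (hmul : ∀ m n : ℕ, Nat.Coprime m n → f (m * n) = f m * f n)
    (hsupp : ∀ p α q : ℕ, p.Prime → 1 ≤ α → q.Prime → q ∣ f (p ^ α) → q ∣ p * f p)
    {n : ℕ} (hn : 0 < n) (hprime : ∀ p, p.Prime → p ∣ n → 0 < f p ∧ f p < p) : 0 < f n := by
  by_contra h
  obtain ⟨q, hqn, hq⟩ := Nat.exists_infinite_primes (n * n + 1)
  obtain ⟨p, hp, hpn, hqp⟩ := exists_prime_dvd_mul_of_dvd_multiplicative hf1 hmul hsupp hq n hn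
    (by simp [Nat.eq_zero_of_not_pos h])
  obtain ⟨hpos, hlt⟩ := hprime p hp hpn
  have hle := Nat.le_of_dvd (Nat.mul_pos hp.pos hpos) hqp
  have hpn' := Nat.le_of_dvd hn hpn
  have : p * f p ≤ n * n := Nat.mul_le_mul hpn' (by omega)
  omega

/-- `f`-orbits of `n` that decrease above `1` end at a value at most `1` within `n` steps. -/
lemma iterate_self_le_one {f : ℕ → ℕ} (hf0 : f 0 = 0) (hf1 : f 1 = 1)
    (hlt : ∀ n, 1 < n → f n < n) (m : ℕ) : ∀ n ≤ m, f^[m] n ≤ 1 := by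
  induction m with
  | zero =>
    intro n hn
    simp only [Function.iterate_zero, id]
    omega
  | succ m ih =>
    intro n hn
    rcases Nat.lt_or_ge 1 n with h | h
    · exact ih _ (by have := hlt n h; omega)
    · interval_cases n
      · simp [Function.iterate_fixed hf0]
      · simp [Function.iterate_fixed hf1]

lemma exists_iterate_eq_one_iff_apply {f : ℕ → ℕ} (hf1 : f 1 = 1) (n : ℕ) :
    (∃ i, f^[i] n = 1) ↔ ∃ i, f^[i] (f n) = 1 := by
  constructor
  · rintro ⟨i, hi⟩
    exact ⟨i, by rw [← Function.iterate_succ_apply, Function.iterate_succ_apply', hi, hf1]⟩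
  · rintro ⟨i, hi⟩
    exact ⟨i + 1, hi⟩

lemma not_exists_iterate_zero_eq_one {f : ℕ → ℕ} (hf0 : f 0 = 0) : ¬∃ i, f^[i] 0 = 1 := by
  rintro ⟨i, hi⟩
  simp [Function.iterate_fixed hf0] at hi

lemma iterate_self_eq_one_iff {f : ℕ → ℕ} (hf0 : f 0 = 0) (hf1 : f 1 = 1)
    (hlt : ∀ n, 1 < n → f n < n) (n : ℕ) : f^[n] n = 1 ↔ ∃ i, f^[i] n = 1 := by
  refine ⟨fun h => ⟨n, h⟩, fun ⟨i, hi⟩ => ?_⟩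
  have hle := iterate_self_le_one hf0 hf1 hlt n n le_rfl
  have key : f^[i] (f^[n] n) = 1 := by
    rw [← Function.iterate_add_apply, Nat.add_comm, Function.iterate_add_apply, hi,
      Function.iterate_fixed hf1]
  rcases Nat.le_one_iff_eq_zero_or_eq_one.1 hle with h | h
  · exact absurd ⟨i, h ▸ key⟩ (not_exists_iterate_zero_eq_one hf0)
  · exact h

lemma exists_iterate_eq_one_iff_forall_prime {f : ℕ → ℕ} (hf0 : f 0 = 0) (hf1 : f 1 = 1)
    (hmul : ∀ m n : ℕ, Nat.Coprime m n → f (m * n) = f m * f n)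
    (hlt : ∀ n, 1 < n → f n < n)
    (hdvd : ∀ p α : ℕ, p.Prime → 1 ≤ α → f p ∣ f (p ^ α))
    (hsupp : ∀ p α q : ℕ, p.Prime → 1 ≤ α → q.Prime → q ∣ f (p ^ α) → q ∣ p * f p) (k : ℕ) :
    0 < k → ((∃ i, f^[i] k = 1) ↔ ∀ q, q.Prime → q ∣ k → ∃ i, f^[i] q = 1) := by
  have hpos : ∀ n, (∃ i, f^[i] n = 1) → 0 < f n := by
    intro n h
    rw [exists_iterate_eq_one_iff_apply hf1] at h
    by_contra h0
    rw [Nat.eq_zero_of_not_pos h0] at h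
    exact not_exists_iterate_zero_eq_one hf0 h
  induction k using Nat.strong_induction_on with
  | _ k ih =>
  intro hk
  rcases Nat.eq_or_lt_of_le (Nat.succ_le_of_lt hk) with rfl | hk1
  · refine ⟨fun _ q hq h => absurd h hq.not_dvd_one, fun _ => ⟨0, rfl⟩⟩
  have hfk := hlt k hk1
  constructor
  · intro h q hq hqk
    have hqle := Nat.le_of_dvd hk hqk
    have hfq := hlt q hq.one_lt
    have hfdvd := multiplicative_prime_dvd hmul hdvd hq hk hqk
    have hfkpos := hpos k h
    rw [exists_iterate_eq_one_iff_apply hf1] at h ⊢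
    rw [ih (f q) (by omega) (Nat.pos_of_dvd_of_pos hfdvd hfkpos)]
    exact fun r hr hrq => (ih (f k) hfk hfkpos).1 h r hr (hrq.trans hfdvd)
  · intro h
    have hfkpos : 0 < f k := multiplicative_pos hf1 hmul hsupp hk
      fun p hp hpk => ⟨hpos p (h p hp hpk), hlt p hp.one_lt⟩
    rw [exists_iterate_eq_one_iff_apply hf1, ih (f k) hfk hfkpos]
    intro q hq hqf
    obtain ⟨p, hp, hpk, hqp⟩ :=
      exists_prime_dvd_mul_of_dvd_multiplicative hf1 hmul hsupp hq k hk hqf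
    have hgood := h p hp hpk
    rcases hq.dvd_mul.1 hqp with hqp | hqp
    · rwa [(Nat.prime_dvd_prime_iff_eq hq hp).1 hqp]
    · have hfp := hlt p hp.one_lt
      have hple := Nat.le_of_dvd hk hpk
      have hfppos := hpos p hgood
      rw [exists_iterate_eq_one_iff_apply hf1] at hgood
      exact (ih (f p) (by omega) hfppos).1 hgood q hq hqp

theorem stmt6 (f : ℕ → ℕ) (hf0 : f 0 = 0) (hf1 : f 1 = 1)
    (hmul : ∀ m n : ℕ, Nat.Coprime m n → f (m * n) = f m * f n)
    (hI : ∀ p α : ℕ, p.Prime → 1 ≤ α → f (p ^ α) < p ^ α)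
    (hII : ∀ p α : ℕ, p.Prime → 1 ≤ α → f p ∣ f (p ^ α))
    (hIII : ∀ p α q : ℕ, p.Prime → 1 ≤ α → q.Prime → q ∣ f (p ^ α) → q ∣ p * f p) :
    ∀ k : ℕ, 0 < k → (f^[k] k = 1 ↔ (1 ≤ k ∧ ∀ q : ℕ, q.Prime → f^[q] q = 0 → ¬q ∣ k)) := by
  have hlt := multiplicative_lt_self hmul hI
  intro k hk
  rw [iterate_self_eq_one_iff hf0 hf1 hlt,
    exists_iterate_eq_one_iff_forall_prime hf0 hf1 hmul hlt hII hIII k hk]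
  have hzero : ∀ q, f^[q] q = 0 ↔ ¬∃ i, f^[i] q = 1 := by
    intro q
    rw [← iterate_self_eq_one_iff hf0 hf1 hlt]
    have := iterate_self_le_one hf0 hf1 hlt q q le_rfl
    omega
  simp only [hzero]
  exact ⟨fun h => ⟨hk, fun q hq hbad hqk => hbad (h q hq hqk)⟩,
    fun h q hq hqk => by_contra fun hbad => h.2 q hq hbad hqk⟩
end

section
/- The iterates of f at n stabilize from step n onward: for every natural number n and every integer m ≥ n, f^m(n) = f^n(n); consequently f^n(n) = lim_{m→∞} f^m(n). -/
/-- A multiplicative function that is strictly smaller than the identity on prime powers is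
strictly smaller than the identity on all integers greater than one. -/
theorem lt_self_of_multiplicative_of_prime_pow_lt {f : ℕ → ℕ}
    (hmul : ∀ m n : ℕ, Nat.Coprime m n → f (m * n) = f m * f n)
    (hlt : ∀ p α : ℕ, p.Prime → 1 ≤ α → f (p ^ α) < p ^ α) (n : ℕ) (hn : 1 < n) : f n < n := by
  induction n using Nat.recOnPosPrimePosCoprime with
  | zero => omega
  | one => omega
  | prime_pow p α hp hα => exact hlt p α hp hα
  | coprime a b ha hb hab iha ihb =>
    rw [hmul a b hab]
    exact Nat.mul_lt_mul'' (iha ha) (ihb hb)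

/-- If `f` fixes `0` and `1` and strictly decreases every larger integer, then `k` iterations
bring every `n ≤ k + 1` down to at most `1`. -/
theorem iterate_le_one_of_lt_self {f : ℕ → ℕ} (h0 : f 0 = 0) (h1 : f 1 = 1)
    (hlt : ∀ n, 1 < n → f n < n) {k n : ℕ} (hn : n ≤ k + 1) : f^[k] n ≤ 1 := by
  induction k generalizing n with
  | zero => simpa using hn
  | succ k ih =>
    rw [Function.iterate_succ_apply]
    apply ih
    obtain rfl | rfl | h : n = 0 ∨ n = 1 ∨ 1 < n := by omega
    · simp [h0]
    · simp [h1]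
    · have := hlt n h
      omega

theorem stmt8 (f : ℕ → ℕ) (hf0 : f 0 = 0) (hf1 : f 1 = 1)
    (hmul : ∀ m n : ℕ, Nat.Coprime m n → f (m * n) = f m * f n)
    (hI : ∀ p α : ℕ, p.Prime → 1 ≤ α → f (p ^ α) < p ^ α)
    (hII : ∀ p α : ℕ, p.Prime → 1 ≤ α → f p ∣ f (p ^ α))
    (hIII : ∀ p α q : ℕ, p.Prime → 1 ≤ α → q.Prime → q ∣ f (p ^ α) → q ∣ p * f p) :
    (∀ n m : ℕ, n ≤ m → f^[m] n = f^[n] n) ∧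
      ∀ n : ℕ, Filter.Tendsto (fun m => f^[m] n) Filter.atTop (nhds (f^[n] n)) := by
  have hstab : ∀ n m : ℕ, n ≤ m → f^[m] n = f^[n] n := by
    intro n m hnm
    have hle : f^[n] n ≤ 1 := iterate_le_one_of_lt_self hf0 hf1
      (lt_self_of_multiplicative_of_prime_pow_lt hmul hI) n.le_succ
    have hfix : f (f^[n] n) = f^[n] n := by
      obtain h | h := Nat.le_one_iff_eq_zero_or_eq_one.mp hle <;> simp [h, hf0, hf1]
    rw [← Nat.sub_add_cancel hnm, Function.iterate_add_apply, Function.iterate_fixed hfix]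
  exact ⟨hstab, fun n => tendsto_atTop_of_eventually_const (hstab n)⟩
end
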